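/- Let f : ℝ^{3×3} → ℝ^{3×3} be an arbitrary function (the prediction network applied to the canonical lattice). Let L ∈ ℝ^{3×3} be invertible and let Q' ∈ ℝ^{3×3} be orthogonal. If L = Q₀H₀ and Q'L = Q₁H₁ are polar decompositions (Q₀, Q₁ orthogonal; H₀, H₁ positive semidefinite), then Q₁ f(H₁) Q₁ᵀ = Q' (Q₀ f(H₀) Q₀ᵀ) Q'ᵀ. That is, the canonicalized dielectric-tensor predictor h(L) = Q₀ f(H₀) Q₀ᵀ is O(3)-equivariant: h(Q'L) = Q' h(L) Q'ᵀ. -/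

import Mathlib

open Matrix

open scoped MatrixOrder Matrix.Norms.L2Operator in
theorem posSemidef_eq_of_mul_self_eq (A B : Matrix (Fin 3) (Fin 3) ℝ)
    (hA : A.PosSemidef) (hB : B.PosSemidef) (h : A * A = B * B) : A = B := by
  have h1 := CFC.sqrt_unique h hA.nonneg
  have h2 := CFC.sqrt_unique (rfl : B * B = B * B) hB.nonneg
  exact h1.symm.trans h2

/-- The canonicalized dielectric-tensor predictor `h(L) = Q₀ f(H₀) Q₀ᵀ` (with `L = Q₀H₀`
the polar decomposition) is `O(3)`-equivariant: `h(Q'L) = Q' h(L) Q'ᵀ`. -/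
theorem canonicalized_dielectric_predictor_equivariant
    (f : Matrix (Fin 3) (Fin 3) ℝ → Matrix (Fin 3) (Fin 3) ℝ)
    (L Q' Q₀ H₀ Q₁ H₁ : Matrix (Fin 3) (Fin 3) ℝ)
    (hL : IsUnit L)
    (hQ' : Q'ᵀ * Q' = 1)
    (hQ₀ : Q₀ᵀ * Q₀ = 1) (hH₀ : H₀.PosSemidef) (hL₀ : L = Q₀ * H₀)
    (hQ₁ : Q₁ᵀ * Q₁ = 1) (hH₁ : H₁.PosSemidef) (hL₁ : Q' * L = Q₁ * H₁) :
    Q₁ * f H₁ * Q₁ᵀ = Q' * (Q₀ * f H₀ * Q₀ᵀ) * Q'ᵀ := by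
  have hT₀ : H₀ᵀ = H₀ := by simpa using hH₀.isHermitian.eq
  have hT₁ : H₁ᵀ = H₁ := by simpa using hH₁.isHermitian.eq
  have e₀ : Lᵀ * L = H₀ * H₀ := by
    rw [hL₀, transpose_mul, hT₀, Matrix.mul_assoc, ← Matrix.mul_assoc Q₀ᵀ, hQ₀, Matrix.one_mul]
  have e₁ : (Q' * L)ᵀ * (Q' * L) = H₁ * H₁ := by
    rw [hL₁, transpose_mul, hT₁, Matrix.mul_assoc, ← Matrix.mul_assoc Q₁ᵀ, hQ₁, Matrix.one_mul]
  have e₂ : (Q' * L)ᵀ * (Q' * L) = Lᵀ * L := by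
    rw [transpose_mul, Matrix.mul_assoc, ← Matrix.mul_assoc Q'ᵀ, hQ', Matrix.one_mul]
  have hH : H₁ = H₀ := posSemidef_eq_of_mul_self_eq _ _ hH₁ hH₀ (by rw [← e₁, e₂, e₀])
  subst hH
  have hu : IsUnit H₁ := by
    have : H₁ = Q₀ᵀ * L := by rw [hL₀, ← Matrix.mul_assoc, hQ₀, Matrix.one_mul]
    rw [this]
    exact (IsUnit.of_mul_eq_one _ hQ₀).mul hL
  have hQ : Q₁ = Q' * Q₀ := by
    apply hu.mul_right_cancel
    rw [← hL₁, hL₀, Matrix.mul_assoc]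
  rw [hQ, transpose_mul]
  simp only [Matrix.mul_assoc]
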